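/- Let m, n ∈ ℕ with m ≥ 2 and n ≥ 2 both odd, and set N := m+n (so N is even). Then the Tornheim double series satisfies T(m,0,n) = ζ(m) ζ(n) − (1/2) ζ(N) − Σ_{k=1}^{N/2−2} binom(N−2−2k, m−1) ζ(2k+1) ζ(N−1−2k) + (−1)^{N/2−1} Y*_{m,n}. -/

import Mathlib

open Real MeasureTheory

/-- Riemann zeta as a real-valued function of a real argument. -/
noncomputable def rzeta (s : ℝ) : ℝ := (riemannZeta (s : ℂ)).re

/-- Tornheim double series. -/
noncomputable def T (a b c : ℝ) : ℝ :=
  ∑' r : ℕ+, ∑' s : ℕ+, 1 / ((r : ℝ) ^ a * (s : ℝ) ^ b * ((r : ℝ) + (s : ℝ)) ^ c)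

/-- Bernoulli polynomial evaluated at a real. -/
noncomputable def B (k : ℕ) (q : ℝ) : ℝ := Polynomial.aeval q (Polynomial.bernoulli k)

/-- Clausen functions: `Cl_n` is a sine sum for `n` even, a cosine sum for `n` odd. -/
noncomputable def Cl (n : ℕ) (x : ℝ) : ℝ :=
  if Even n then ∑' k : ℕ+, Real.sin (k * x) / (k : ℝ) ^ n
  else ∑' k : ℕ+, Real.cos (k * x) / (k : ℝ) ^ n

/-- The integrals `X_{k,l}`. -/
noncomputable def X (k l : ℕ) : ℝ :=
  (-1 : ℝ) ^ (l / 2) * ((l.factorial : ℝ) / (2 * π) ^ l) *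
    ∫ q in (0:ℝ)..1, Real.log (Real.Gamma q) * B k q * Cl (l + 1) (2 * π * q)

/-- The combination `Y*_{m,n}`, where the weight is `N = m + n`. -/
noncomputable def Ystar (m n : ℕ) : ℝ :=
  (2 * (2 * π) ^ (m + n - 2)) / ((m.factorial : ℝ) * ((m + n - m - 2).factorial : ℝ)) *
    ∑ j ∈ Finset.range (m + 1), (-1 : ℝ) ^ j * (m.choose j : ℝ) * X j (m + n - 2 - j)
  + (-1 : ℝ) ^ ((m + n) / 2 - 1) * ((m + n - 2).choose (m - 1) : ℝ) *
      rzeta (m + n - 1) * Real.log (2 * π)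

theorem B_eq_bernoulliFun (k : ℕ) (q : ℝ) : B k q = bernoulliFun k q := by
  rw [B, bernoulliFun, Polynomial.eval_map_algebraMap]

theorem continuous_B (k : ℕ) : Continuous (B k) := by
  rw [funext (B_eq_bernoulliFun k)]
  exact continuous_bernoulliFun k

theorem B_one_sub (k : ℕ) (q : ℝ) : B k (1 - q) = (-1) ^ k * B k q := by
  simp only [B_eq_bernoulliFun, bernoulliFun_eval_one_sub]

/-- The Bernoulli polynomial `(2π)^j B_j(q) / j!` times a cosine of frequency `c`, phase-shifted so
that only `c ^ (-j)` survives in the integral over the unit interval. -/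
noncomputable def bernoulliCos (j : ℕ) (c q : ℝ) : ℝ :=
  (2 * π) ^ j / j.factorial * B j q * cos (2 * π * c * q - j * (π / 2))

theorem continuous_bernoulliCos (j : ℕ) (c : ℝ) : Continuous (bernoulliCos j c) := by
  have := continuous_B j
  unfold bernoulliCos
  fun_prop

theorem bernoulliCos_one_sub (j : ℕ) (c : ℤ) (q : ℝ) :
    bernoulliCos j c (1 - q) = bernoulliCos j c q := by
  have h : cos (2 * π * c * (1 - q) - j * (π / 2)) =
      (-1) ^ j * cos (2 * π * c * q - j * (π / 2)) := by
    rw [← cos_neg (2 * π * c * q - j * (π / 2)), ← cos_sub_nat_mul_pi,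
      ← cos_add_int_mul_two_pi (-(2 * π * c * q - j * (π / 2)) - j * π) c]
    congr 1; ring
  have h1 : (-1 : ℝ) ^ j * (-1) ^ j = 1 := by rw [← mul_pow]; simp
  rw [bernoulliCos, bernoulliCos, B_one_sub, h]
  linear_combination (2 * π) ^ j / j.factorial * B j q *
    cos (2 * π * c * q - j * (π / 2)) * h1

theorem bernoulliCos_mul_cos (j : ℕ) (b k q : ℝ) :
    bernoulliCos j b q * cos (2 * π * k * q) =
      (bernoulliCos j (b + k) q + bernoulliCos j (b - k) q) / 2 := by
  have h1 : 2 * π * (b + k) * q - j * (π / 2) =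
    (2 * π * b * q - j * (π / 2)) + 2 * π * k * q := by ring
  have h2 : 2 * π * (b - k) * q - j * (π / 2) =
    (2 * π * b * q - j * (π / 2)) - 2 * π * k * q := by ring
  rw [bernoulliCos, bernoulliCos, bernoulliCos, h1, h2]
  generalize 2 * π * b * q - j * (π / 2) = x
  rw [cos_add, cos_sub]
  ring

theorem integral_bernoulliCos {j : ℕ} (hj : j ≠ 0) (c : ℤ) :
    ∫ q in (0:ℝ)..1, bernoulliCos j c q = -((c : ℝ) ^ j)⁻¹ := by
  unfold bernoulliCos
  have h := bernoulliFourierCoeff_eq hj (-c)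
  rw [bernoulliFourierCoeff, fourierCoeffOn_eq_integral] at h
  simp only [sub_zero, ne_eq, one_ne_zero, not_false_eq_true, div_self, one_smul, neg_neg,
    smul_eq_mul] at h
  have h' : ∫ q in (0:ℝ)..1, fourier c (q : AddCircle (1:ℝ)) * (bernoulliFun j q : ℂ) =
      -(j.factorial : ℂ) / (2 * π * Complex.I * ((-c : ℤ) : ℂ)) ^ j := by
    rw [← h]
    simp only [fourier_coe_apply, sub_zero]
  have hint : ∀ q : ℝ, ((2 * π) ^ j / j.factorial * B j q * cos (2 * π * c * q - j * (π / 2))) =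
      RCLike.re ((((2 * π) ^ j / j.factorial : ℝ) : ℂ) * (-Complex.I) ^ j *
        (fourier c (q : AddCircle (1:ℝ)) * (bernoulliFun j q : ℂ))) := by
    intro q
    have hI : (-Complex.I) ^ j = Complex.exp (-(j * (π / 2) * Complex.I)) := by
      rw [← Complex.exp_neg_pi_div_two_mul_I, ← Complex.exp_nat_mul]
      congr 1; ring
    have e : (((2 * π) ^ j / j.factorial : ℝ) : ℂ) * (-Complex.I) ^ j *
        (fourier c (q : AddCircle (1:ℝ)) * (bernoulliFun j q : ℂ)) =
        (((2 * π) ^ j / j.factorial * B j q : ℝ) : ℂ) *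
          Complex.exp ((2 * π * c * q - j * (π / 2) : ℝ) * Complex.I) := by
      rw [fourier_coe_apply, hI, B_eq_bernoulliFun]
      have : Complex.exp ((2 * π * c * q - j * (π / 2) : ℝ) * Complex.I) =
        Complex.exp (-(j * (π / 2) * Complex.I)) *
          Complex.exp (2 * π * Complex.I * c * q / (1:ℝ)) := by
        rw [← Complex.exp_add]; congr 1; push_cast; ring
      rw [this]; push_cast; ring
    rw [e, RCLike.re_eq_complex_re, Complex.re_ofReal_mul, Complex.exp_ofReal_mul_I_re]
  simp_rw [hint]
  have hi : IntervalIntegrable (fun q : ℝ ↦ (((2 * π) ^ j / j.factorial : ℝ) : ℂ) *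
      (-Complex.I) ^ j * (fourier c (q : AddCircle (1:ℝ)) * (bernoulliFun j q : ℂ)))
      volume 0 1 := by
    apply Continuous.intervalIntegrable
    have := (map_continuous (fourier (T := (1:ℝ)) c)).comp (AddCircle.continuous_mk' (1:ℝ))
    have h2 := Complex.continuous_ofReal.comp (continuous_bernoulliFun j)
    exact continuous_const.mul (this.mul h2)
  rw [intervalIntegral.integral_of_le zero_le_one,
    integral_re ((intervalIntegrable_iff_integrableOn_Ioc_of_le zero_le_one).1 hi),
    ← intervalIntegral.integral_of_le zero_le_one, intervalIntegral.integral_const_mul, h']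
  have : (((2 * π) ^ j / j.factorial : ℝ) : ℂ) * (-Complex.I) ^ j *
      (-(j.factorial : ℂ) / (2 * π * Complex.I * ((-c : ℤ) : ℂ)) ^ j) =
      ((-((c : ℝ) ^ j)⁻¹ : ℝ) : ℂ) := by
    have hf : (j.factorial : ℂ) ≠ 0 := by exact_mod_cast j.factorial_ne_zero
    have hp : (π : ℂ) ≠ 0 := by exact_mod_cast pi_ne_zero
    have e : (2 * π * Complex.I * ((-c : ℤ) : ℂ)) ^ j =
        (2 * π) ^ j * (-Complex.I) ^ j * (c : ℂ) ^ j := by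
      rw [← mul_pow, ← mul_pow]; congr 1; push_cast; ring
    rw [e]
    have h2 : (-Complex.I) ^ j ≠ 0 := pow_ne_zero _ (neg_ne_zero.2 Complex.I_ne_zero)
    have h3 : ((2:ℂ) * π) ^ j ≠ 0 := pow_ne_zero _ (mul_ne_zero two_ne_zero hp)
    push_cast
    generalize ((2:ℂ) * π) ^ j = u at *
    generalize (-Complex.I) ^ j = v at *
    rcases eq_or_ne ((c : ℂ) ^ j) 0 with h0 | h0
    · simp [h0]
    · field_simp
  rw [this]
  exact Complex.ofReal_re _

theorem norm_one_sub_exp (q : ℝ) :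
    ‖1 - Complex.exp ((2 * π * q : ℝ) * Complex.I)‖ = 2 * |sin (π * q)| := by
  rw [norm_sub_rev, mul_comm, Complex.norm_exp_I_mul_ofReal_sub_one]
  rw [norm_mul, Real.norm_eq_abs, Real.norm_eq_abs, abs_two]
  congr 3; ring

theorem hasSum_abel_log_sin {q r : ℝ} (hr0 : 0 ≤ r) (hr1 : r < 1) :
    HasSum (fun k : ℕ ↦ r ^ k * (cos (2 * π * k * q) / k))
      (-Real.log ‖1 - r * Complex.exp ((2 * π * q : ℝ) * Complex.I)‖) := by
  have hz : ‖(r : ℂ) * Complex.exp ((2 * π * q : ℝ) * Complex.I)‖ < 1 := by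
    rw [norm_mul, Complex.norm_exp_ofReal_mul_I, Complex.norm_real, norm_of_nonneg hr0]
    linarith
  have h := Complex.hasSum_re (Complex.hasSum_taylorSeries_neg_log hz)
  rw [Complex.neg_re, Complex.log_re] at h
  convert h using 2 with k
  rw [mul_pow, ← Complex.exp_nat_mul, ← Complex.ofReal_pow, mul_div_assoc, Complex.re_ofReal_mul,
    Complex.div_natCast_re]
  congr 2
  rw [← Complex.exp_ofReal_mul_I_re]
  congr 2; push_cast; ring

theorem intervalIntegrable_log_sin_pi :
    IntervalIntegrable (fun q : ℝ ↦ Real.log (sin (π * q))) volume 0 1 := by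
  have := (intervalIntegrable_log_sin (a := 0) (b := π)).comp_mul_left (c := π)
  simpa [pi_ne_zero] using this

theorem sin_pi_mul_pos {q : ℝ} (h0 : 0 < q) (h1 : q < 1) : 0 < sin (π * q) := by
  apply sin_pos_of_pos_of_lt_pi (by positivity)
  nlinarith [pi_pos]

theorem abs_log_norm_le {q r : ℝ} (h0 : 0 < q) (h1 : q < 1) (hr0 : 0 ≤ r) (hr1 : r < 1) :
    |-Real.log ‖1 - r * Complex.exp ((2 * π * q : ℝ) * Complex.I)‖| ≤
      Real.log 2 - Real.log (sin (π * q)) := by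
  have hs := sin_pi_mul_pos h0 h1
  set z := Complex.exp ((2 * π * q : ℝ) * Complex.I) with hz
  have hz1 : ‖z‖ = 1 := Complex.norm_exp_ofReal_mul_I _
  have hrz : ‖(r : ℂ) * z‖ = r := by
    rw [norm_mul, hz1, Complex.norm_real, norm_of_nonneg hr0, mul_one]
  have hup : ‖1 - (r : ℂ) * z‖ ≤ 2 := by
    have := norm_sub_le (1 : ℂ) (r * z)
    rw [hrz, norm_one] at this; linarith
  have hlow : sin (π * q) ≤ ‖1 - (r : ℂ) * z‖ := by
    have h2 := norm_one_sub_exp q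
    rw [← hz, abs_of_pos hs] at h2
    have h3 : ‖1 - z‖ ≤ ‖1 - (r : ℂ) * z‖ + (1 - r) := by
      have e : 1 - z = (1 - (r : ℂ) * z) + (((r - 1 : ℝ) : ℂ) * z) := by push_cast; ring
      rw [e]
      refine (norm_add_le _ _).trans ?_
      rw [norm_mul, hz1, Complex.norm_real, Real.norm_eq_abs, abs_of_neg (by linarith)]
      linarith
    have h4 := norm_sub_norm_le (1 : ℂ) (r * z)
    rw [hrz, norm_one] at h4
    linarith
  have l1 := Real.log_le_log hs hlow
  have l2 := Real.log_le_log (hs.trans_le hlow) hup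
  have l3 : 0 ≤ Real.log 2 := Real.log_nonneg (by norm_num)
  have l4 : Real.log (sin (π * q)) ≤ 0 := Real.log_nonpos hs.le (sin_le_one _)
  rw [abs_neg, abs_le]
  constructor <;> linarith

open Filter Topology in
theorem integral_log_two_sin_mul {g : ℝ → ℝ} (hg : Continuous g)
    (hs : Summable fun k : ℕ ↦ (∫ q in (0:ℝ)..1, g q * cos (2 * π * k * q)) / k) :
    ∫ q in (0:ℝ)..1, -Real.log (2 * sin (π * q)) * g q =
      ∑' k : ℕ, (∫ q in (0:ℝ)..1, g q * cos (2 * π * k * q)) / k := by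
  obtain ⟨M, hM⟩ := isCompact_Icc.exists_bound_of_continuousOn (s := Set.Icc (0:ℝ) 1)
    hg.continuousOn
  have hM' : ∀ q ∈ Set.uIoc (0:ℝ) 1, |g q| ≤ M := fun q hq ↦
    hM q (Set.Ioc_subset_Icc_self (by rwa [Set.uIoc_of_le zero_le_one] at hq))
  have hM0 : 0 ≤ M := (norm_nonneg _).trans (hM 0 (by simp))
  set L : ℝ → ℝ → ℝ := fun r q ↦
    -Real.log ‖1 - r * Complex.exp ((2 * π * q : ℝ) * Complex.I)‖ with hL
  have hne : ∀ᵐ q : ℝ, q ≠ 1 := by simp [ae_iff]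
  have hmeas : ∀ r, Measurable (L r) := by intro r; simp only [hL]; fun_prop
  have hr : ∀ᶠ r : ℝ in 𝓝[<] 1, r ∈ Set.Ico (0:ℝ) 1 := Ico_mem_nhdsLT (by norm_num)
  have lim1 : Tendsto (fun r ↦ ∫ q in (0:ℝ)..1, L r q * g q) (𝓝[<] 1)
      (𝓝 (∫ q in (0:ℝ)..1, -Real.log (2 * sin (π * q)) * g q)) := by
    apply intervalIntegral.tendsto_integral_filter_of_dominated_convergence
      (fun q ↦ (Real.log 2 - Real.log (sin (π * q))) * M)
    · exact Eventually.of_forall fun r ↦ ((hmeas r).mul hg.measurable).aestronglyMeasurable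
    · filter_upwards [hr] with r hr
      filter_upwards [hne] with q hq1 hq
      have hq' := hq
      rw [Set.uIoc_of_le zero_le_one] at hq
      rw [norm_mul]
      have hb := abs_log_norm_le hq.1 (lt_of_le_of_ne hq.2 hq1) hr.1 hr.2
      exact mul_le_mul hb (hM' q hq') (abs_nonneg _) ((abs_nonneg _).trans hb)
    · exact (intervalIntegrable_const.sub intervalIntegrable_log_sin_pi).mul_const M
    · filter_upwards [hne] with q hq1 hq
      rw [Set.uIoc_of_le zero_le_one] at hq
      have hsin := sin_pi_mul_pos hq.1 (lt_of_le_of_ne hq.2 hq1)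
      refine Tendsto.mul_const _ ?_
      have e := norm_one_sub_exp q
      rw [abs_of_pos hsin] at e
      rw [← e]
      have hc : ContinuousAt (fun r : ℝ ↦ L r q) 1 := by
        simp only [hL]
        refine (ContinuousAt.log (by fun_prop) ?_).neg
        rw [Complex.ofReal_one, one_mul, e]; positivity
      have := hc.tendsto
      simp only [hL, Complex.ofReal_one, one_mul] at this
      exact this.mono_left nhdsWithin_le_nhds
  have eqr : ∀ r ∈ Set.Ico (0:ℝ) 1, ∫ q in (0:ℝ)..1, L r q * g q =
      ∑' k : ℕ, r ^ k * ((∫ q in (0:ℝ)..1, g q * cos (2 * π * k * q)) / k) := by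
    intro r hr
    have := intervalIntegral.hasSum_integral_of_dominated_convergence (μ := volume)
      (a := 0) (b := 1) (F := fun (k : ℕ) q ↦ r ^ k * (cos (2 * π * k * q) / k) * g q)
      (f := fun q ↦ L r q * g q)
      (fun k _ ↦ r ^ k * M)
      (fun k ↦ by
        apply Continuous.aestronglyMeasurable
        fun_prop)
      (fun k ↦ ae_of_all _ fun q hq ↦ by
        rw [norm_mul, norm_mul, norm_pow, norm_of_nonneg hr.1]
        refine mul_le_mul ?_ (hM' q hq) (norm_nonneg _) (pow_nonneg hr.1 _)
        refine mul_le_of_le_one_right (pow_nonneg hr.1 _) ?_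
        rw [norm_div, Real.norm_natCast]
        rcases Nat.eq_zero_or_pos k with h | h
        · simp [h]
        · rw [div_le_one (by exact_mod_cast h)]
          exact (abs_cos_le_one _).trans (by exact_mod_cast h))
      (ae_of_all _ fun q _ ↦ (summable_geometric_of_lt_one hr.1 hr.2).mul_right M)
      (by simp)
      (ae_of_all _ fun q _ ↦ (hasSum_abel_log_sin hr.1 hr.2).mul_right (g q))
    rw [← this.tsum_eq]
    congr 1; ext k
    rw [← intervalIntegral.integral_div, ← intervalIntegral.integral_const_mul]
    congr 1; ext q; ring
  have lim2 : Tendsto (fun r : ℝ ↦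
      ∑' k : ℕ, r ^ k * ((∫ q in (0:ℝ)..1, g q * cos (2 * π * k * q)) / k)) (𝓝[<] 1)
      (𝓝 (∑' k : ℕ, (∫ q in (0:ℝ)..1, g q * cos (2 * π * k * q)) / k)) := by
    refine tendsto_tsum_of_dominated_convergence hs.norm (fun k ↦ ?_) ?_
    · have : Tendsto (fun r : ℝ ↦ r ^ k * ((∫ q in (0:ℝ)..1, g q * cos (2 * π * k * q)) / k))
        (𝓝 1) (𝓝 (1 ^ k * ((∫ q in (0:ℝ)..1, g q * cos (2 * π * k * q)) / k))) :=
        Continuous.tendsto (by fun_prop) 1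
      rw [one_pow, one_mul] at this
      exact this.mono_left nhdsWithin_le_nhds
    · filter_upwards [hr] with r hr k
      rw [norm_mul, norm_pow, norm_of_nonneg hr.1]
      exact mul_le_of_le_one_left (norm_nonneg _) (pow_le_one₀ hr.1 hr.2.le)
  refine tendsto_nhds_unique (lim1.congr' ?_) lim2
  filter_upwards [hr] with r hr using eqr r hr

theorem intervalIntegrable_log_Gamma :
    IntervalIntegrable (fun q ↦ Real.log (Real.Gamma q)) volume 0 1 := by
  have h1 : IntervalIntegrable (fun q ↦ Real.log (Real.Gamma (q + 1)) - Real.log q) volume 0 1 := by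
    refine IntervalIntegrable.sub ?_ intervalIntegral.intervalIntegrable_log'
    refine ContinuousOn.intervalIntegrable fun q hq ↦ ?_
    rw [Set.uIcc_of_le zero_le_one] at hq
    have hq0 : 0 < q + 1 := by linarith [hq.1]
    have hG : ContinuousAt (fun q : ℝ ↦ Real.Gamma (q + 1)) q := by
      refine ContinuousAt.comp (g := Real.Gamma) (f := fun q : ℝ ↦ q + 1) (x := q) ?_ (by fun_prop)
      refine (differentiableAt_Gamma fun k ↦ ?_).continuousAt
      have : (0:ℝ) ≤ k := k.cast_nonneg
      intro h; linarith
    exact (ContinuousAt.log hG (Gamma_pos_of_pos hq0).ne').continuousWithinAt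
  refine h1.congr_ae ?_
  rw [Set.uIoc_of_le zero_le_one]
  filter_upwards [ae_restrict_mem measurableSet_Ioc] with q hq
  rw [Gamma_add_one hq.1.ne', Real.log_mul hq.1.ne' (Gamma_pos_of_pos hq.1).ne']
  ring

theorem integral_log_Gamma_mul_of_symm {h : ℝ → ℝ} (hc : Continuous h)
    (hs : ∀ q, h (1 - q) = h q) :
    ∫ q in (0:ℝ)..1, Real.log (Real.Gamma q) * h q =
      (Real.log (2 * π) * (∫ q in (0:ℝ)..1, h q) +
        ∫ q in (0:ℝ)..1, -Real.log (2 * sin (π * q)) * h q) / 2 := by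
  have hi : IntervalIntegrable (fun q ↦ Real.log (Real.Gamma q) * h q) volume 0 1 :=
    intervalIntegrable_log_Gamma.mul_continuousOn hc.continuousOn
  have hi' : IntervalIntegrable (fun q ↦ Real.log (Real.Gamma (1 - q)) * h (1 - q))
      volume 0 1 := by
    simpa using (hi.comp_sub_left 1).symm
  have hne : ∀ᵐ q : ℝ, q ≠ 1 := by simp [ae_iff]
  have key : ∀ᵐ q : ℝ, q ∈ Set.uIoc (0:ℝ) 1 →
      Real.log (Real.Gamma q) * h q + Real.log (Real.Gamma (1 - q)) * h (1 - q) =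
      Real.log (2 * π) * h q + -Real.log (2 * sin (π * q)) * h q := by
    filter_upwards [hne] with q hq1 hq
    rw [Set.uIoc_of_le zero_le_one] at hq
    have hq1 : q < 1 := lt_of_le_of_ne hq.2 hq1
    have hsin := sin_pi_mul_pos hq.1 hq1
    have h2 := congrArg Real.log (Real.Gamma_mul_Gamma_one_sub q)
    rw [Real.log_mul (Gamma_pos_of_pos hq.1).ne' (Gamma_pos_of_pos (by linarith)).ne',
      Real.log_div pi_ne_zero hsin.ne'] at h2
    rw [hs, Real.log_mul two_ne_zero pi_ne_zero, Real.log_mul two_ne_zero hsin.ne']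
    linear_combination h q * h2
  have hL : IntervalIntegrable (fun q ↦ -Real.log (2 * sin (π * q)) * h q) volume 0 1 := by
    have e : IntervalIntegrable (fun q ↦ Real.log (Real.Gamma q) * h q +
      Real.log (Real.Gamma (1 - q)) * h (1 - q) - Real.log (2 * π) * h q) volume 0 1 :=
      (hi.add hi').sub ((hc.intervalIntegrable 0 1).const_mul _)
    refine e.congr_ae ?_
    rw [Filter.EventuallyEq, ae_restrict_iff' measurableSet_uIoc]
    filter_upwards [key] with q hq hq'
    rw [hq hq']; ring
  have hrefl := intervalIntegral.integral_comp_sub_left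
    (fun q ↦ Real.log (Real.Gamma q) * h q) (a := 0) (b := 1) 1
  simp only [sub_zero, sub_self] at hrefl
  have hsum := intervalIntegral.integral_congr_ae key
  rw [intervalIntegral.integral_add hi hi', hrefl,
    intervalIntegral.integral_add ((hc.intervalIntegrable 0 1).const_mul _) hL,
    intervalIntegral.integral_const_mul] at hsum
  linarith

theorem integral_cos_two_pi_int (c : ℤ) :
    ∫ q in (0:ℝ)..1, bernoulliCos 0 c q = if c = 0 then 1 else 0 := by
  simp only [bernoulliCos, B, pow_zero, Nat.factorial_zero, Nat.cast_one, div_one,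
    Polynomial.bernoulli_zero, map_one, one_mul, CharP.cast_eq_zero, zero_mul, sub_zero]
  split_ifs with h
  · simp [h]
  · have hc : 2 * π * (c : ℝ) ≠ 0 := by
      have : (c : ℝ) ≠ 0 := by exact_mod_cast h
      positivity
    rw [intervalIntegral.integral_comp_mul_left (fun x ↦ cos x) hc, integral_cos]
    have : sin (2 * π * c * 1) = 0 := by
      rw [show 2 * π * (c:ℝ) * 1 = ((2 * c : ℤ) : ℝ) * π by push_cast; ring]
      exact sin_int_mul_pi _
    rw [this]; simp

theorem integral_bernoulliCos_mul_cos {j : ℕ} (b k : ℤ) :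
    ∫ q in (0:ℝ)..1, bernoulliCos j b q * cos (2 * π * k * q) =
      ((∫ q in (0:ℝ)..1, bernoulliCos j (b + k : ℤ) q) +
        ∫ q in (0:ℝ)..1, bernoulliCos j (b - k : ℤ) q) / 2 := by
  simp_rw [bernoulliCos_mul_cos]
  rw [intervalIntegral.integral_div, intervalIntegral.integral_add
    ((continuous_bernoulliCos _ _).intervalIntegrable _ _)
    ((continuous_bernoulliCos _ _).intervalIntegrable _ _)]
  push_cast; rfl

theorem abs_inv_sub_pow_div_le {j : ℕ} (hj : j ≠ 0) (b k : ℕ+) :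
    |(((b : ℝ) - k) ^ j)⁻¹ / k| ≤ ((b : ℝ) + 1) * (1 / (k : ℝ) ^ 2) := by
  have hk : (0:ℝ) < k := by exact_mod_cast k.pos
  rcases eq_or_ne b k with rfl | h
  · simp [hj]; positivity
  have h1 : (1:ℝ) ≤ |(b : ℝ) - k| := by
    have : ((b : ℤ) - k) ≠ 0 := by
      rw [sub_ne_zero]; exact_mod_cast h
    exact_mod_cast Int.one_le_abs this
  have h2 : |(b : ℝ) - k| ≤ |(b : ℝ) - k| ^ j := le_self_pow₀ h1 hj
  have h3 : (k : ℝ) ≤ (b + 1) * |(b : ℝ) - k| := by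
    have hb : (0:ℝ) ≤ b := b.val.cast_nonneg
    have := neg_abs_le ((b : ℝ) - k)
    nlinarith
  rw [abs_div, abs_inv, abs_pow, abs_of_pos hk, inv_eq_one_div, div_div, mul_one_div,
    div_le_div_iff₀ (by positivity) (by positivity)]
  have : (k : ℝ) ^ 2 = k * k := by ring
  rw [one_mul, this]
  have hb : (0:ℝ) ≤ (b : ℝ) + 1 := by positivity
  calc (k:ℝ) * k ≤ ((b + 1) * |(b : ℝ) - k|) * k := by gcongr
    _ ≤ ((b + 1) * |(b : ℝ) - k| ^ j) * k := by gcongr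
    _ = _ := by ring

theorem abs_inv_add_pow_div_le {j : ℕ} (hj : j ≠ 0) (b k : ℕ+) :
    |(((b : ℝ) + k) ^ j)⁻¹ / k| ≤ 1 / (k : ℝ) ^ 2 := by
  have hk : (1:ℝ) ≤ k := by exact_mod_cast k.pos
  have hb : (0:ℝ) < b := by exact_mod_cast b.pos
  have h2 : (b : ℝ) + k ≤ ((b : ℝ) + k) ^ j := le_self_pow₀ (by linarith) hj
  rw [abs_of_nonneg (by positivity), inv_eq_one_div, div_div]
  gcongr
  nlinarith

theorem summable_one_div_pnat_pow {p : ℕ} (hp : 1 < p) :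
    Summable fun k : ℕ+ ↦ 1 / (k : ℝ) ^ p :=
  (summable_pnat_iff_summable_nat (f := fun k : ℕ ↦ 1 / (k : ℝ) ^ p)).2
    (summable_one_div_nat_pow.2 hp)

theorem summable_inv_sub_pow_div {j : ℕ} (hj : j ≠ 0) (b : ℕ+) :
    Summable fun k : ℕ+ ↦ (((b : ℝ) - k) ^ j)⁻¹ / k :=
  Summable.of_norm_bounded ((summable_one_div_pnat_pow one_lt_two).mul_left _)
    (abs_inv_sub_pow_div_le hj b)

theorem summable_inv_add_pow_div {j : ℕ} (hj : j ≠ 0) (b : ℕ+) :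
    Summable fun k : ℕ+ ↦ (((b : ℝ) + k) ^ j)⁻¹ / k :=
  Summable.of_norm_bounded (summable_one_div_pnat_pow one_lt_two)
    (abs_inv_add_pow_div_le hj b)

theorem hasSum_integral_log_Gamma_mul_bernoulliCos {j : ℕ} {b : ℕ+} {f : ℕ+ → ℝ}
    (hf : Summable f)
    (h : ∀ k : ℕ+, ((∫ q in (0:ℝ)..1, bernoulliCos j ((b + k : ℤ) : ℝ) q) +
        ∫ q in (0:ℝ)..1, bernoulliCos j ((b - k : ℤ) : ℝ) q) / 2 / k = 2 * f k) :
    HasSum f ((∫ q in (0:ℝ)..1, Real.log (Real.Gamma q) * bernoulliCos j b q) -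
      Real.log (2 * π) / 2 * ∫ q in (0:ℝ)..1, bernoulliCos j b q) := by
  have hk : ∀ k : ℕ+, (∫ q in (0:ℝ)..1, bernoulliCos j b q * cos (2 * π * (k : ℕ) * q)) /
      ((k : ℕ) : ℝ) = 2 * f k := by
    intro k
    rw [← h, ← integral_bernoulliCos_mul_cos]
    push_cast; rfl
  have hs : Summable fun k : ℕ ↦
      (∫ q in (0:ℝ)..1, bernoulliCos j b q * cos (2 * π * k * q)) / k := by
    rw [← summable_pnat_iff_summable_nat]
    simp_rw [hk]
    exact hf.mul_left 2
  have e := integral_log_two_sin_mul (continuous_bernoulliCos j b) hs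
  rw [← tsum_zero_pnat_eq_tsum_nat hs] at e
  simp_rw [hk] at e
  rw [integral_log_Gamma_mul_of_symm (continuous_bernoulliCos j b)
    (fun q ↦ bernoulliCos_one_sub j b q), e, tsum_mul_left]
  convert hf.hasSum using 1
  simp
  ring

theorem hasSum_integral_log_Gamma_mul_bernoulliCos_of_ne_zero {j : ℕ} (hj : j ≠ 0) (b : ℕ+) :
    HasSum (fun k : ℕ+ ↦ -((((b : ℝ) + k) ^ j)⁻¹ + (((b : ℝ) - k) ^ j)⁻¹) / k / 4)
      ((∫ q in (0:ℝ)..1, Real.log (Real.Gamma q) * bernoulliCos j b q) +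
        Real.log (2 * π) / 2 * ((b : ℝ) ^ j)⁻¹) := by
  have h1 := (summable_inv_add_pow_div hj b).add (summable_inv_sub_pow_div hj b)
  have := hasSum_integral_log_Gamma_mul_bernoulliCos (j := j) (b := b)
    (f := fun k : ℕ+ ↦ -((((b : ℝ) + k) ^ j)⁻¹ + (((b : ℝ) - k) ^ j)⁻¹) / k / 4)
    ((h1.mul_left (-1 / 4)).congr fun k ↦ by ring)
    (fun k ↦ by
      rw [integral_bernoulliCos hj, integral_bernoulliCos hj]
      push_cast; ring)
  convert this using 1
  have e := integral_bernoulliCos hj b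
  push_cast at e
  rw [e]; ring

theorem hasSum_integral_log_Gamma_mul_bernoulliCos_zero (b : ℕ+) :
    HasSum (fun k : ℕ+ ↦ if k = b then (b : ℝ)⁻¹ / 4 else 0)
      (∫ q in (0:ℝ)..1, Real.log (Real.Gamma q) * bernoulliCos 0 b q) := by
  have := hasSum_integral_log_Gamma_mul_bernoulliCos (j := 0) (b := b)
    (f := fun k : ℕ+ ↦ if k = b then (b : ℝ)⁻¹ / 4 else 0)
    (hasSum_ite_eq b _).summable
    (fun k ↦ by
      rw [integral_cos_two_pi_int, integral_cos_two_pi_int, if_neg (by positivity)]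
      rcases eq_or_ne k b with rfl | h
      · simp; ring
      · have : (b : ℤ) - k ≠ 0 := by
          rw [sub_ne_zero]; exact_mod_cast h.symm
        simp [this, h])
  convert this using 1
  have e := integral_cos_two_pi_int b
  push_cast at e
  rw [e, if_neg (by exact_mod_cast b.ne_zero)]; simp

/-- The part of the partial fraction expansion of `u ^ (p + 1) * v ^ (q + 1)` carrying the powers
of `u`, when `u * v = w * (u + v)`. -/
def partialFractionSum (p q : ℕ) (u w : ℝ) : ℝ :=
  ∑ i ∈ Finset.range (p + 1), ((p + q - i).choose q : ℝ) * u ^ (i + 1) * w ^ (p + q + 1 - i)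

theorem partialFractionSum_succ_succ (p q : ℕ) (u w : ℝ) :
    partialFractionSum (p + 1) (q + 1) u w =
      w * (partialFractionSum p (q + 1) u w + partialFractionSum (p + 1) q u w) := by
  have h : partialFractionSum p (q + 1) u w = ∑ i ∈ Finset.range (p + 1 + 1),
      ((p + (q + 1) - i).choose (q + 1) : ℝ) * u ^ (i + 1) * w ^ (p + (q + 1) + 1 - i) := by
    rw [Finset.sum_range_succ, partialFractionSum, show p + (q + 1) - (p + 1) = q by omega,
      Nat.choose_succ_self]
    simp
  rw [h, partialFractionSum, partialFractionSum, ← Finset.sum_add_distrib, Finset.mul_sum]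
  refine Finset.sum_congr rfl fun i hi ↦ ?_
  rw [Finset.mem_range] at hi
  rw [show p + 1 + (q + 1) - i = (p + 1 + q - i) + 1 by omega,
    show p + (q + 1) - i = p + 1 + q - i by omega, Nat.choose_succ_succ,
    show p + 1 + (q + 1) + 1 - i = (p + 1 + q + 1 - i) + 1 by omega,
    show p + (q + 1) + 1 - i = p + 1 + q + 1 - i by omega]
  push_cast; ring

theorem partialFractionSum_zero_left (q : ℕ) (u w : ℝ) :
    partialFractionSum 0 q u w = u * w ^ (q + 1) := by
  simp [partialFractionSum]

theorem partialFractionSum_succ_zero (p : ℕ) (u w : ℝ) :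
    partialFractionSum (p + 1) 0 u w = w * (partialFractionSum p 0 u w + u ^ (p + 2)) := by
  rw [partialFractionSum, Finset.sum_range_succ, partialFractionSum, mul_add, Finset.mul_sum]
  congr 1
  · refine Finset.sum_congr rfl fun i hi ↦ ?_
    rw [Finset.mem_range] at hi
    rw [show p + 1 + 0 + 1 - i = (p + 0 + 1 - i) + 1 by omega]
    simp; ring
  · simp; ring

theorem pow_succ_mul_eq {u v w : ℝ} (h : u * v = w * (u + v)) (p : ℕ) :
    u ^ (p + 1) * v = partialFractionSum p 0 u w + partialFractionSum 0 p v w := by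
  induction p with
  | zero => simp only [partialFractionSum_zero_left]; linear_combination h
  | succ p ih =>
    rw [partialFractionSum_succ_zero, partialFractionSum_zero_left]
    rw [partialFractionSum_zero_left] at ih
    linear_combination w * ih + u ^ (p + 1) * h

theorem pow_mul_pow_eq_partialFractionSum {u v w : ℝ} (h : u * v = w * (u + v)) (p q : ℕ) :
    u ^ (p + 1) * v ^ (q + 1) = partialFractionSum p q u w + partialFractionSum q p v w := by
  induction p generalizing q with
  | zero =>
    have := pow_succ_mul_eq (u := v) (v := u) (w := w) (by linear_combination h) q
    linear_combination this
  | succ p ihp =>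
    induction q with
    | zero => simpa using pow_succ_mul_eq h (p + 1)
    | succ q ihq =>
      rw [partialFractionSum_succ_succ, partialFractionSum_succ_succ]
      linear_combination u ^ (p + 1) * v ^ (q + 1) * h + w * ihq + w * ihp (q + 1)

theorem sum_choose_sub (p q : ℕ) :
    ∑ i ∈ Finset.range (q + 1), (p + q - i).choose p = (p + q + 1).choose (p + 1) := by
  induction q with
  | zero => simp
  | succ q ih =>
    rw [Finset.sum_range_succ', show p + (q + 1) + 1 = (p + q + 1) + 1 by omega,
      Nat.choose_succ_succ, ← ih, add_comm]
    congr 1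
    refine Finset.sum_congr rfl fun i _ ↦ ?_
    congr 1; omega

theorem partialFractionSum_self (p q : ℕ) (w : ℝ) :
    partialFractionSum q p w w = ((p + q + 1).choose (p + 1) : ℝ) * w ^ (p + q + 2) := by
  rw [partialFractionSum, ← sum_choose_sub, Nat.cast_sum, Finset.sum_mul]
  refine Finset.sum_congr rfl fun i hi ↦ ?_
  rw [Finset.mem_range] at hi
  rw [mul_assoc, ← pow_add, add_comm q p]
  congr 2; omega

theorem partialFractionSum_inv_sub (p q : ℕ) (b k : ℕ+) :
    partialFractionSum p q ((b : ℝ) - k)⁻¹ (b : ℝ)⁻¹ =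
      (((b : ℝ) - k) ^ (p + 1))⁻¹ * ((k : ℝ) ^ (q + 1))⁻¹ -
        partialFractionSum q p (k : ℝ)⁻¹ (b : ℝ)⁻¹ +
        if k = b then ((p + q + 1).choose (p + 1) : ℝ) * (b : ℝ)⁻¹ ^ (p + q + 2) else 0 := by
  have hb : (b : ℝ) ≠ 0 := by exact_mod_cast b.ne_zero
  have hk : (k : ℝ) ≠ 0 := by exact_mod_cast k.ne_zero
  split_ifs with h
  · subst h
    rw [partialFractionSum_self]
    simp [partialFractionSum]
  · have hbk : (b : ℝ) - k ≠ 0 := by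
      rw [sub_ne_zero]; exact_mod_cast Ne.symm h
    have := pow_mul_pow_eq_partialFractionSum (u := ((b : ℝ) - k)⁻¹) (v := (k : ℝ)⁻¹)
      (w := (b : ℝ)⁻¹) (by field_simp; ring) p q
    rw [inv_pow, inv_pow] at this
    linarith

theorem partialFractionSum_inv_add (p q : ℕ) (b k : ℕ+) :
    partialFractionSum p q ((b : ℝ) + k)⁻¹ (b : ℝ)⁻¹ =
      (((b : ℝ) + k) ^ (p + 1))⁻¹ * ((-(k : ℝ)) ^ (q + 1))⁻¹ -
        partialFractionSum q p (-(k : ℝ))⁻¹ (b : ℝ)⁻¹ := by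
  have hb : (b : ℝ) ≠ 0 := by exact_mod_cast b.ne_zero
  have hk : (k : ℝ) ≠ 0 := by exact_mod_cast k.ne_zero
  have hbk : (b : ℝ) + k ≠ 0 := by positivity
  have := pow_mul_pow_eq_partialFractionSum (u := ((b : ℝ) + k)⁻¹) (v := (-(k : ℝ))⁻¹)
    (w := (b : ℝ)⁻¹) (by field_simp; ring) p q
  rw [inv_pow, inv_pow] at this
  linarith

theorem hasSum_rzeta {p : ℕ} (hp : 1 < p) :
    HasSum (fun k : ℕ+ ↦ ((k : ℝ) ^ p)⁻¹) (rzeta p) := by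
  have hs : Summable fun k : ℕ ↦ ((k : ℝ) ^ p)⁻¹ := Real.summable_nat_pow_inv.2 hp
  have h : rzeta p = ∑' k : ℕ, ((k : ℝ) ^ p)⁻¹ := by
    rw [rzeta, Complex.ofReal_natCast, zeta_nat_eq_tsum_of_gt_one hp, ← Complex.ofReal_re
      (∑' k : ℕ, ((k : ℝ) ^ p)⁻¹), Complex.ofReal_tsum]
    simp
  rw [h, ← tsum_zero_pnat_eq_tsum_nat hs]
  simp only [Nat.cast_zero, zero_pow (by omega : p ≠ 0), inv_zero, zero_add]
  exact (summable_pnat_iff_summable_nat.2 hs).hasSum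

theorem hasSum_rzeta_mul {m n : ℕ} (hm : 1 < m) (hn : 1 < n) :
    HasSum (fun x : ℕ+ × ℕ+ ↦ ((x.1 : ℝ) ^ m)⁻¹ * ((x.2 : ℝ) ^ n)⁻¹) (rzeta m * rzeta n) := by
  have h := hasSum_rzeta hm
  have h' := hasSum_rzeta hn
  have s := summable_mul_of_summable_norm h.summable.norm h'.summable.norm
  simpa only using h.mul h' s

theorem hasSum_T {m n : ℕ} (hm : 1 < m) (hn : 1 < n) :
    HasSum (fun x : ℕ+ × ℕ+ ↦ ((x.1 : ℝ) ^ m)⁻¹ * (((x.1 : ℝ) + x.2) ^ n)⁻¹) (T m 0 n) := by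
  have hs : Summable fun x : ℕ+ × ℕ+ ↦ ((x.1 : ℝ) ^ m)⁻¹ * (((x.1 : ℝ) + x.2) ^ n)⁻¹ := by
    refine Summable.of_nonneg_of_le (fun x ↦ by positivity) (fun x ↦ ?_)
      (hasSum_rzeta_mul hm hn).summable
    have h2 : (0:ℝ) < x.2 := by exact_mod_cast x.2.pos
    gcongr
    simp
  convert hs.hasSum using 1
  rw [hs.tsum_prod, T]
  refine tsum_congr fun r ↦ tsum_congr fun s ↦ ?_
  simp only [rpow_natCast, rpow_zero, mul_one, one_div, mul_inv]

theorem hasSum_of_trichotomy {F : ℕ+ × ℕ+ → ℝ} {a b c : ℝ}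
    (ha : HasSum (fun x : ℕ+ × ℕ+ ↦ F (x.1 + x.2, x.2)) a)
    (hb : HasSum (fun x : ℕ+ × ℕ+ ↦ F (x.1, x.1 + x.2)) b)
    (hc : HasSum (fun r : ℕ+ ↦ F (r, r)) c) : HasSum F (a + b + c) := by
  let e : (ℕ+ × ℕ+ ⊕ ℕ+ × ℕ+) ⊕ ℕ+ → ℕ+ × ℕ+ :=
    Sum.elim (Sum.elim (fun x ↦ (x.1 + x.2, x.2)) fun x ↦ (x.1, x.1 + x.2)) fun r ↦ (r, r)
  have he : Function.Bijective e := by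
    constructor
    · refine Function.Injective.sumElim (Function.Injective.sumElim ?_ ?_ ?_) ?_ ?_
      · rintro ⟨r, s⟩ ⟨r', s'⟩ h
        simp only [Prod.mk.injEq] at h ⊢
        exact ⟨add_right_cancel (h.2 ▸ h.1), h.2⟩
      · rintro ⟨r, s⟩ ⟨r', s'⟩ h
        simp only [Prod.mk.injEq] at h ⊢
        exact ⟨h.1, add_left_cancel (h.1 ▸ h.2)⟩
      · rintro ⟨r, s⟩ ⟨r', s'⟩ h
        simp only [Prod.mk.injEq, ← PNat.coe_inj, PNat.add_coe] at h
        have := r.pos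
        have := s'.pos
        omega
      · exact fun r r' h ↦ (Prod.mk.inj h).1
      · rintro (⟨r, s⟩ | ⟨r, s⟩) r' h <;>
        · simp only [Sum.elim_inl, Sum.elim_inr, Prod.mk.injEq, ← PNat.coe_inj, PNat.add_coe] at h
          have := r.pos
          have := s.pos
          omega
    · rintro ⟨r, s⟩
      rcases lt_trichotomy r s with h | h | h
      · exact ⟨Sum.inl (Sum.inr (r, s - r)), by simp [e, PNat.add_sub_of_lt h]⟩
      · exact ⟨Sum.inr r, by simp [e, h]⟩
      · exact ⟨Sum.inl (Sum.inl (r - s, s)), by simp [e, add_comm, PNat.add_sub_of_lt h]⟩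
  rw [← (Equiv.ofBijective e he).hasSum_iff]
  exact HasSum.sum (HasSum.sum ha hb) hc

theorem hasSum_inv_add_pow_mul_inv_pow {m n : ℕ} (hm : 1 < m) (hn : 1 < n) :
    HasSum (fun x : ℕ+ × ℕ+ ↦ (((x.1 : ℝ) + x.2) ^ m)⁻¹ * ((x.2 : ℝ) ^ n)⁻¹) (T n 0 m) := by
  convert (Equiv.prodComm ℕ+ ℕ+).hasSum_iff.2 (hasSum_T hn hm) using 2 with x
  simp [mul_comm, add_comm]

theorem rzeta_mul_rzeta_eq {m n : ℕ} (hm : 1 < m) (hn : 1 < n) :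
    rzeta m * rzeta n = T n 0 m + T m 0 n + rzeta (m + n : ℕ) := by
  refine (hasSum_rzeta_mul hm hn).unique (hasSum_of_trichotomy ?_ ?_ ?_)
  · simpa using hasSum_inv_add_pow_mul_inv_pow hm hn
  · simpa using hasSum_T hm hn
  · simpa only [pow_add, mul_inv] using hasSum_rzeta (by omega : 1 < m + n)

theorem hasSum_inv_sub_pow_mul_inv_pow {m n : ℕ} (hm : 1 < m) (hn : 1 < n) (hmo : Odd m) :
    HasSum (fun x : ℕ+ × ℕ+ ↦ (((x.1 : ℝ) - x.2) ^ m)⁻¹ * ((x.2 : ℝ) ^ n)⁻¹)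
      (rzeta m * rzeta n - T m 0 n) := by
  rw [sub_eq_add_neg, ← add_zero (_ + _)]
  refine hasSum_of_trichotomy ?_ ?_ ?_
  · simpa using hasSum_rzeta_mul hm hn
  · refine ((Equiv.prodComm ℕ+ ℕ+).hasSum_iff.2 (hasSum_T hm hn)).neg.congr_fun fun x ↦ ?_
    simp only [sub_add_cancel_left, hmo.neg_pow, inv_neg, Function.comp_apply,
      Equiv.prodComm_apply, Prod.fst_swap, Prod.snd_swap, PNat.add_coe, Nat.cast_add, add_comm,
      neg_mul]
  · simp [show m ≠ 0 by omega]

theorem hasSum_integral_log_Gamma_mul_bernoulliCos_sum (p q : ℕ) (hq : Odd q) (b : ℕ+) :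
    HasSum (fun k : ℕ+ ↦
      -(1 / 2) * ((((b : ℝ) - k) ^ (p + 1))⁻¹ * ((k : ℝ) ^ (q + 2))⁻¹ +
        (((b : ℝ) + k) ^ (p + 1))⁻¹ * ((k : ℝ) ^ (q + 2))⁻¹) +
      (partialFractionSum q p (k : ℝ)⁻¹ (b : ℝ)⁻¹ + partialFractionSum q p (-(k : ℝ))⁻¹ (b : ℝ)⁻¹) *
        (k : ℝ)⁻¹ / 2)
      (2 * ∑ j ∈ Finset.range (p + 2), ((p + q + 1 - j).choose q : ℝ) * (b : ℝ)⁻¹ ^ (p + q + 2 - j) *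
        (∫ x in (0:ℝ)..1, Real.log (Real.Gamma x) * bernoulliCos j b x) +
      Real.log (2 * π) * ((p + q + 1).choose p : ℝ) * (b : ℝ)⁻¹ ^ (p + q + 2)) := by
  have hb : (b : ℝ) ≠ 0 := by exact_mod_cast b.ne_zero
  have hsym : (p + q + 1).choose q = (p + q + 1).choose (p + 1) :=
    Nat.choose_symm_of_eq_add (by omega)
  have hsym' : (q + p + 1).choose (q + 1) = (p + q + 1).choose p := by
    rw [add_comm q p]; exact Nat.choose_symm_of_eq_add (by omega)
  have h0 := (hasSum_integral_log_Gamma_mul_bernoulliCos_zero b).mul_left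
    (2 * (((p + q + 1).choose q : ℝ) * (b : ℝ)⁻¹ ^ (p + q + 2)))
  have h1 := hasSum_sum (s := Finset.range (p + 1)) fun i _ ↦
    (hasSum_integral_log_Gamma_mul_bernoulliCos_of_ne_zero i.succ_ne_zero b).mul_left
      (2 * (((p + q - i).choose q : ℝ) * (b : ℝ)⁻¹ ^ (p + q + 1 - i)))
  convert h0.add h1 using 1
  · rfl
  · funext k
    have hk : (k : ℝ) ≠ 0 := by exact_mod_cast k.ne_zero
    have e : ∑ i ∈ Finset.range (p + 1), 2 * (((p + q - i).choose q : ℝ) *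
        (b : ℝ)⁻¹ ^ (p + q + 1 - i)) *
        (-((((b : ℝ) + k) ^ (i + 1))⁻¹ + (((b : ℝ) - k) ^ (i + 1))⁻¹) / k / 4) =
        -(partialFractionSum p q ((b : ℝ) + k)⁻¹ (b : ℝ)⁻¹ +
          partialFractionSum p q ((b : ℝ) - k)⁻¹ (b : ℝ)⁻¹) / k / 2 := by
      simp only [partialFractionSum, ← Finset.sum_add_distrib, ← Finset.sum_neg_distrib,
        Finset.sum_div]
      refine Finset.sum_congr rfl fun i _ ↦ ?_
      simp only [inv_pow]; ring
    rw [e, partialFractionSum_inv_sub, partialFractionSum_inv_add, hq.add_one.neg_pow, hsym]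
    split_ifs with h
    · subst h; field_simp; ring
    · field_simp; ring
  · have e : Real.log (2 * π) * ((p + q + 1).choose p : ℝ) * (b : ℝ)⁻¹ ^ (p + q + 2) =
        ∑ i ∈ Finset.range (p + 1), 2 * (((p + q - i).choose q : ℝ) *
          (b : ℝ)⁻¹ ^ (p + q + 1 - i)) * (Real.log (2 * π) / 2 * ((b : ℝ) ^ (i + 1))⁻¹) := by
      rw [mul_assoc, ← hsym', add_comm p q, ← partialFractionSum_self, partialFractionSum,
        Finset.mul_sum, add_comm p q]
      refine Finset.sum_congr rfl fun i _ ↦ ?_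
      simp only [inv_pow]; ring
    rw [Finset.sum_range_succ', e]
    simp only [mul_add, Finset.sum_add_distrib, Finset.mul_sum, Nat.succ_eq_add_one,
      Nat.add_sub_add_right, Nat.sub_zero, mul_assoc, show p + q + 2 = p + q + 1 + 1 by rfl]
    ring

theorem hasSum_tornheim_kernel {p q : ℕ} (hp : Even p) (hp0 : p ≠ 0) :
    HasSum (fun x : ℕ+ × ℕ+ ↦
      -(1 / 2) * ((((x.1 : ℝ) - x.2) ^ (p + 1))⁻¹ * ((x.2 : ℝ) ^ (q + 2))⁻¹ +
        (((x.1 : ℝ) + x.2) ^ (p + 1))⁻¹ * ((x.2 : ℝ) ^ (q + 2))⁻¹) +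
      (partialFractionSum q p (x.2 : ℝ)⁻¹ (x.1 : ℝ)⁻¹ +
        partialFractionSum q p (-(x.2 : ℝ))⁻¹ (x.1 : ℝ)⁻¹) * (x.2 : ℝ)⁻¹ / 2)
      (-(1 / 2) * (2 * (rzeta (p + 1 : ℕ) * rzeta (q + 2 : ℕ)) - 2 * T (p + 1 : ℕ) 0 (q + 2 : ℕ) -
          rzeta (p + 1 + (q + 2) : ℕ)) +
        ∑ i ∈ Finset.range (q + 1), if Odd i then ((q + p - i).choose p : ℝ) *
          rzeta (i + 2 : ℕ) * rzeta (q + p + 1 - i : ℕ) else 0) := by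
  have hm : 1 < p + 1 := by omega
  have hn : 1 < q + 2 := by omega
  refine HasSum.add ?_ ?_
  · convert ((hasSum_inv_sub_pow_mul_inv_pow hm hn hp.add_one).add
      (hasSum_inv_add_pow_mul_inv_pow hm hn)).mul_left (-(1 / 2) : ℝ) using 2
    · rfl
    have := rzeta_mul_rzeta_eq hm hn
    linarith
  · have h : ∀ i ∈ Finset.range (q + 1), HasSum (fun x : ℕ+ × ℕ+ ↦ if Odd i then
        ((q + p - i).choose p : ℝ) * (((x.1 : ℝ) ^ (q + p + 1 - i))⁻¹ * ((x.2 : ℝ) ^ (i + 2))⁻¹)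
        else 0) (if Odd i then ((q + p - i).choose p : ℝ) *
          rzeta (i + 2 : ℕ) * rzeta (q + p + 1 - i : ℕ) else 0) := by
      intro i hi
      rw [Finset.mem_range] at hi
      split_ifs
      · convert (hasSum_rzeta_mul (m := q + p + 1 - i) (n := i + 2)
          (by omega) (by omega)).mul_left ((q + p - i).choose p : ℝ) using 1
        · rfl
        ring
      · exact hasSum_zero
    convert hasSum_sum h using 1
    funext x
    simp only [partialFractionSum, ← Finset.sum_add_distrib, Finset.sum_mul, Finset.sum_div]
    refine Finset.sum_congr rfl fun i _ ↦ ?_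
    rcases Nat.even_or_odd i with hi | hi
    · rw [if_neg (Nat.not_odd_iff_even.2 hi), inv_neg, hi.add_one.neg_pow]
      ring
    · rw [if_pos hi, inv_neg, hi.add_one.neg_pow]
      simp only [← inv_pow]
      ring

theorem hasSum_cos_sub_div_pow {j p : ℕ} (hp : 1 < p) (hjp : Odd (j + p)) (x : ℝ) :
    HasSum (fun b : ℕ+ ↦ cos (b * x - j * (π / 2)) / (b : ℝ) ^ p) ((-1) ^ (j / 2) * Cl p x) := by
  have hs : ∀ f : ℝ → ℝ, (∀ y, |f y| ≤ 1) → Summable fun b : ℕ+ ↦ f (b * x) / (b : ℝ) ^ p := by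
    refine fun f hf ↦ Summable.of_norm_bounded (summable_one_div_pnat_pow hp) fun b ↦ ?_
    rw [Real.norm_eq_abs, abs_div, abs_of_nonneg (by positivity : (0:ℝ) ≤ (b : ℝ) ^ p)]
    gcongr
    exact hf _
  rcases Nat.even_or_odd' j with ⟨a, rfl | rfl⟩
  · have hp' : ¬ Even p := by
      rw [Nat.not_even_iff_odd]; exact (Nat.odd_add'.1 hjp).2 (even_two_mul a)
    rw [Cl, if_neg hp', show 2 * a / 2 = a by omega]
    refine ((hs cos abs_cos_le_one).hasSum.mul_left _).congr_fun fun b ↦ ?_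
    rw [show (b : ℝ) * x - (2 * a : ℕ) * (π / 2) = b * x - a * π by push_cast; ring,
      Real.cos_sub_nat_mul_pi, mul_div_assoc]
  · have hp' : Even p := (Nat.odd_add.1 hjp).1 (odd_two_mul_add_one a)
    rw [Cl, if_pos hp', show (2 * a + 1) / 2 = a by omega]
    refine ((hs sin abs_sin_le_one).hasSum.mul_left _).congr_fun fun b ↦ ?_
    rw [show (b : ℝ) * x - (2 * a + 1 : ℕ) * (π / 2) = b * x - a * π - π / 2 by push_cast; ring,
      Real.cos_sub_pi_div_two, Real.sin_sub_nat_mul_pi, mul_div_assoc]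

theorem hasSum_inv_pow_mul_integral {j p : ℕ} (hp : 1 < p) (hjp : Odd (j + p)) :
    HasSum (fun b : ℕ+ ↦ (b : ℝ)⁻¹ ^ p *
        ∫ q in (0:ℝ)..1, Real.log (Real.Gamma q) * bernoulliCos j b q)
      ((2 * π) ^ j / j.factorial * (-1) ^ (j / 2) *
        ∫ q in (0:ℝ)..1, Real.log (Real.Gamma q) * B j q * Cl p (2 * π * q)) := by
  have hB : Continuous fun q ↦ (2 * π) ^ j / (j.factorial : ℝ) * B j q :=
    continuous_const.mul (continuous_B j)
  have hi := intervalIntegrable_log_Gamma.mul_continuousOn hB.continuousOn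
  simp_rw [← intervalIntegral.integral_const_mul]
  refine intervalIntegral.hasSum_integral_of_dominated_convergence
    (fun (b : ℕ+) q ↦ 1 / (b : ℝ) ^ p *
      |Real.log (Real.Gamma q) * ((2 * π) ^ j / (j.factorial : ℝ) * B j q)|) (fun b ↦ ?_)
    (fun b ↦ ?_) ?_ ?_ ?_
  · exact ((intervalIntegrable_log_Gamma.mul_continuousOn
      (continuous_bernoulliCos j b).continuousOn).const_mul _).aestronglyMeasurable_restrict_uIoc
  · refine Filter.Eventually.of_forall fun q _ ↦ ?_
    have h := abs_cos_le_one (2 * π * b * q - j * (π / 2))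
    rw [Real.norm_eq_abs, bernoulliCos, ← mul_assoc (Real.log _), abs_mul, abs_mul,
      inv_pow, abs_inv, abs_of_nonneg (by positivity : (0:ℝ) ≤ (b : ℝ) ^ p), one_div]
    gcongr
    exact mul_le_of_le_one_right (abs_nonneg _) h
  · exact Filter.Eventually.of_forall fun q _ ↦ (summable_one_div_pnat_pow hp).mul_right _
  · simp_rw [tsum_mul_right]
    exact hi.abs.const_mul _
  · refine Filter.Eventually.of_forall fun q _ ↦ ?_
    convert (hasSum_cos_sub_div_pow hp hjp (2 * π * q)).mul_left
      (Real.log (Real.Gamma q) * ((2 * π) ^ j / (j.factorial : ℝ) * B j q)) using 1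
    · rfl
    · funext b
      rw [bernoulliCos, inv_pow, show (b : ℝ) * (2 * π * q) = 2 * π * b * q by ring]
      ring
    · ring

theorem factorial_mul_choose_eq {p q j : ℕ} (hj : j ≤ p + 1) :
    ((p + 1).choose j : ℝ) * (p + q + 1 - j).factorial / ((p + 1).factorial * q.factorial) =
      (p + q + 1 - j).choose q / j.factorial := by
  rw [Nat.cast_choose ℝ hj, Nat.cast_choose ℝ (by omega : q ≤ p + q + 1 - j),
    show p + q + 1 - j - q = p + 1 - j by omega]
  field_simp

theorem neg_one_pow_half_mul {M l j : ℕ} (h : j + l = 2 * M) :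
    (-1 : ℝ) ^ M * (-1) ^ j * (-1) ^ (l / 2) = (-1) ^ (j / 2) := by
  rw [← pow_add, ← pow_add]
  rcases Nat.even_or_odd' j with ⟨a, rfl | rfl⟩
  · rw [show M + 2 * a + l / 2 = 2 * M + 2 * a / 2 by omega, pow_add, pow_mul]
    norm_num
  · rw [show M + (2 * a + 1) + l / 2 = 2 * M + (2 * a + 1) / 2 by omega, pow_add, pow_mul]
    norm_num

theorem hasSum_Ystar {p q M : ℕ} (hq : q ≠ 0) (hM : p + q + 1 = 2 * M) :
    HasSum (fun b : ℕ+ ↦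
      2 * ∑ j ∈ Finset.range (p + 2), ((p + q + 1 - j).choose q : ℝ) * (b : ℝ)⁻¹ ^ (p + q + 2 - j) *
        (∫ x in (0:ℝ)..1, Real.log (Real.Gamma x) * bernoulliCos j b x) +
      Real.log (2 * π) * ((p + q + 1).choose p : ℝ) * (b : ℝ)⁻¹ ^ (p + q + 2))
      ((-1) ^ M * Ystar (p + 1) (q + 2)) := by
  have h : ∀ j ∈ Finset.range (p + 2), HasSum (fun b : ℕ+ ↦ ((p + q + 1 - j).choose q : ℝ) *
      (b : ℝ)⁻¹ ^ (p + q + 2 - j) *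
        ∫ x in (0:ℝ)..1, Real.log (Real.Gamma x) * bernoulliCos j b x)
      ((-1) ^ M * (2 * π) ^ (p + q + 1) / ((p + 1).factorial * q.factorial) *
        ((-1) ^ j * ((p + 1).choose j : ℝ) * X j (p + q + 1 - j))) := by
    intro j hj
    rw [Finset.mem_range] at hj
    convert (hasSum_inv_pow_mul_integral (j := j) (p := p + q + 2 - j) (by omega)
      ⟨M, by omega⟩).mul_left ((p + q + 1 - j).choose q : ℝ) using 1
    · rfl
    · funext b; ring
    · rw [X, show p + q + 1 - j + 1 = p + q + 2 - j by omega,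
        ← neg_one_pow_half_mul (by omega : j + (p + q + 1 - j) = 2 * M),
        show (2 * π) ^ (p + q + 1) = (2 * π) ^ j * (2 * π) ^ (p + q + 1 - j) by
          rw [← pow_add]; congr 1; omega]
      have e := factorial_mul_choose_eq (q := q) (by omega : j ≤ p + 1)
      have hc : (2 * π) ^ (p + q + 1 - j) * (((p + q + 1 - j).factorial : ℝ) /
          (2 * π) ^ (p + q + 1 - j)) = (p + q + 1 - j).factorial :=
        mul_div_cancel₀ _ (by positivity)
      generalize (∫ x in (0:ℝ)..1, Real.log (Real.Gamma x) * B j x * _) = I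
      generalize ((p + q + 1 - j).factorial : ℝ) / (2 * π) ^ (p + q + 1 - j) = r at hc ⊢
      generalize (2 * π) ^ (p + q + 1 - j) = t at hc ⊢
      linear_combination (-(1 : ℝ)) ^ M * (-1) ^ j * (-1) ^ ((p + q + 1 - j) / 2) * (2 * π) ^ j * I *
        (e + (p + 1).choose j / ((p + 1).factorial * q.factorial) * hc)
  convert ((hasSum_sum h).mul_left 2).add ((hasSum_rzeta (by omega : 1 < p + q + 2)).mul_left
    (Real.log (2 * π) * ((p + q + 1).choose p : ℝ))) using 1
  · rfl
  · simp only [inv_pow]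
  · rw [Ystar, ← Finset.mul_sum, show p + 1 + (q + 2) - 2 = p + q + 1 by omega,
      show p + 1 + (q + 2) - (p + 1) - 2 = q by omega,
      show (p + 1 + (q + 2)) / 2 - 1 = M by omega,
      show (((p + 1 : ℕ) : ℝ) + (q + 2 : ℕ) - 1) = (p + q + 2 : ℕ) by push_cast; ring]
    have hs : (-1 : ℝ) ^ M * (-1) ^ M = 1 := by rw [← mul_pow]; norm_num
    rw [show p + 1 - 1 = p by omega]
    linear_combination ((p + q + 1).choose p : ℝ) * rzeta (p + q + 2 : ℕ) * Real.log (2 * π) * hs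

theorem sum_range_odd_eq_sum_Icc (f : ℕ → ℝ) (t : ℕ) :
    ∑ i ∈ Finset.range (2 * t), (if Odd i then f i else 0) =
      ∑ k ∈ Finset.Icc 1 t, f (2 * k - 1) := by
  induction t with
  | zero => simp
  | succ t ih =>
    rw [Finset.sum_Icc_succ_top (by omega), ← ih, show 2 * (t + 1) = 2 * t + 1 + 1 by ring,
      Finset.sum_range_succ, Finset.sum_range_succ, if_neg (by simp), if_pos (by simp)]
    simp

theorem tornheim_even_weight_odd_odd (m n : ℕ) (hm : 2 ≤ m) (hn : 2 ≤ n)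
    (hmo : Odd m) (hno : Odd n) :
    T m 0 n = rzeta m * rzeta n - (1 / 2) * rzeta (m + n)
      - ∑ k ∈ Finset.Icc 1 ((m + n) / 2 - 2),
          (((m + n) - 2 - 2 * k).choose (m - 1) : ℝ) *
            rzeta (2 * k + 1) * rzeta ((m + n) - 1 - 2 * k)
      + (-1 : ℝ) ^ ((m + n) / 2 - 1) * Ystar m n := by
  obtain ⟨s, rfl⟩ := hmo
  obtain ⟨t, rfl⟩ : ∃ t, n = 2 * t + 1 + 2 := by
    obtain ⟨t, rfl⟩ := hno
    exact ⟨t - 1, by omega⟩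
  have h1 := (hasSum_tornheim_kernel (q := 2 * t + 1) (even_two_mul s) (by omega)).prod_fiberwise
    fun b ↦ hasSum_integral_log_Gamma_mul_bernoulliCos_sum (2 * s) (2 * t + 1)
      (odd_two_mul_add_one t) b
  have h2 := hasSum_Ystar (p := 2 * s) (q := 2 * t + 1) (M := s + t + 1) (by omega) (by ring)
  have h3 := h1.unique h2
  have hsum : ∑ k ∈ Finset.Icc 1 ((2 * s + 1 + (2 * t + 1 + 2)) / 2 - 2),
      ((2 * s + 1 + (2 * t + 1 + 2) - 2 - 2 * k).choose (2 * s + 1 - 1) : ℝ) *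
        rzeta (2 * k + 1) *
        rzeta (((2 * s + 1 : ℕ) : ℝ) + (2 * t + 1 + 2 : ℕ) - 1 - 2 * k) =
      ∑ i ∈ Finset.range (2 * t + 1 + 1), if Odd i then
        ((2 * t + 1 + 2 * s - i).choose (2 * s) : ℝ) * rzeta (i + 2 : ℕ) *
          rzeta (2 * t + 1 + 2 * s + 1 - i : ℕ) else 0 := by
    rw [show 2 * t + 1 + 1 = 2 * (t + 1) by ring, sum_range_odd_eq_sum_Icc]
    symm
    refine Finset.sum_subset_zero_on_sdiff (Finset.Icc_subset_Icc_right (by omega)) ?_ ?_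
    · intro k hk
      simp only [Finset.mem_sdiff, Finset.mem_Icc] at hk
      rw [Nat.choose_eq_zero_of_lt (by omega)]
      simp
    · intro k hk
      rw [Finset.mem_Icc] at hk
      have e1 : ((2 * k - 1 + 2 : ℕ) : ℝ) = 2 * k + 1 := by
        rw [show 2 * k - 1 + 2 = 2 * k + 1 by omega]; push_cast; ring
      have e2 : ((2 * t + 1 + 2 * s + 1 - (2 * k - 1) : ℕ) : ℝ) =
          ((2 * s + 1 : ℕ) : ℝ) + (2 * t + 1 + 2 : ℕ) - 1 - 2 * k := by
        rw [show 2 * t + 1 + 2 * s + 1 - (2 * k - 1) = 2 * t + 2 * s + 3 - 2 * k by omega,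
          Nat.cast_sub (by omega)]
        push_cast; ring
      rw [e1, e2, show 2 * t + 1 + 2 * s - (2 * k - 1) =
        2 * s + 1 + (2 * t + 1 + 2) - 2 - 2 * k by omega, Nat.add_sub_cancel]
  rw [hsum, show (2 * s + 1 + (2 * t + 1 + 2)) / 2 - 1 = s + t + 1 by omega, ← h3, ← Nat.cast_add]
  ring
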